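/- Let $z = (z_i^{(j)})$ be real numbers such that $z_1^{(1)},\dots,z_n^{(1)}$ are pairwise distinct. Then for any two $k$-element subsets $I, J \subseteq \{1,\dots,n\}$, $\dfrac{1}{c_1}\,\partial_I\,\partial_J\,P(z) = \dfrac{1}{c_2}\,\sum_{m=1}^n z_m^{(1)}\,\dfrac{\partial}{\partial z_m^{(1)}}\,\partial_I\,\partial_J\,Q(z)$. -/

import Mathlib

noncomputable section

/-- The set `𝒜` of sequences `α = ({p₁,q₁},…,{p_k,q_k})` of `k` pairwise disjoint
unordered two-element subsets of `{1,…,n}`, encoded as `k`-tuples of ordered pairs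
`(p_i, q_i)` with `p_i < q_i` whose underlying two-element sets are pairwise disjoint. -/
def pairSeqs (n k : ℕ) : Finset (Fin k → Fin n × Fin n) :=
  Finset.univ.filter fun α =>
    (∀ i, (α i).1 < (α i).2) ∧
    ∀ i j, i ≠ j →
      Disjoint ({(α i).1, (α i).2} : Finset (Fin n)) {(α j).1, (α j).2}

/-- Points of `ℝ^{nk}` with coordinates `z_i^{(j)}` indexed by `(i,j) : Fin n × Fin k`. -/
abbrev Pt (n k : ℕ) := Fin n × Fin k → ℝ

/-- Partial derivative of a function of `z : Pt n k` with respect to the coordinate `v`. -/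
def pd {n k : ℕ} (v : Fin n × Fin k) (f : Pt n k → ℝ) : Pt n k → ℝ :=
  fun x => fderiv ℝ f x (Pi.single v 1)

/-- Iterated partial derivative `∂/∂z_{g(1)}^{(1)} ⋯ ∂/∂z_{g(k)}^{(k)}`. -/
def pdSeq {n k : ℕ} (g : Fin k → Fin n) (f : Pt n k → ℝ) : Pt n k → ℝ :=
  (List.finRange k).foldl (fun h j => pd (g j, j) h) f

/-- The differential operator
`∂_I = ∑_{σ ∈ S_k} ∂^k / ∂z_{i_{σ(1)}}^{(1)} ⋯ ∂z_{i_{σ(k)}}^{(k)}`, realized as the sum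
over all bijections `g` from `{1,…,k}` onto the `k`-element subset `I`. -/
def pdI {n k : ℕ} (I : Finset (Fin n)) (f : Pt n k → ℝ) : Pt n k → ℝ :=
  fun x =>
    ∑ g ∈ Finset.univ.filter
        (fun g : Fin k → Fin n => Function.Injective g ∧ ∀ j, g j ∈ I),
      pdSeq g f x

/-- The constant `c₂ = -(n-2k+1)! / (2^k (k-1)! (n-k)!)`. -/
def c2 (n k : ℕ) : ℝ :=
  -((n - 2 * k + 1).factorial : ℝ) /
    (2 ^ k * ((k - 1).factorial : ℝ) * ((n - k).factorial : ℝ))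

/-- The potential of the second kind
`Q = c₂ ∑_{α ∈ 𝒜} ln|z_{p₁}^{(1)} - z_{q₁}^{(1)}| ∏_{i=1}^k (z_{p_i}^{(i)} - z_{q_i}^{(i)})²`. -/
def Qfun (n k : ℕ) (hk : 0 < k) : Pt n k → ℝ := fun z =>
  c2 n k *
    ∑ α ∈ pairSeqs n k,
      Real.log |z ((α ⟨0, hk⟩).1, ⟨0, hk⟩) - z ((α ⟨0, hk⟩).2, ⟨0, hk⟩)| *
        ∏ i : Fin k, (z ((α i).1, i) - z ((α i).2, i)) ^ 2

/-- The constant `c₁ = (n-2k+1)! / (2^k k! (n-k+1)!)`. -/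
def c1 (n k : ℕ) : ℝ :=
  ((n - 2 * k + 1).factorial : ℝ) /
    (2 ^ k * (k.factorial : ℝ) * ((n - k + 1).factorial : ℝ))

/-- The potential of the first kind
`P = c₁ ∑_{α ∈ 𝒜} ∏_{i=1}^k (z_{p_i}^{(i)} - z_{q_i}^{(i)})²` as a function on `ℝ^{nk}`. -/
def Pfun (n k : ℕ) : Pt n k → ℝ := fun z =>
  c1 n k * ∑ α ∈ pairSeqs n k, ∏ i : Fin k, (z ((α i).1, i) - z ((α i).2, i)) ^ 2

/-- The coordinate difference `z_{p_i}^{(i)} - z_{q_i}^{(i)}`. -/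
def pairDiff {n k : ℕ} (α : Fin k → Fin n × Fin n) (i : Fin k) (z : Pt n k) : ℝ :=
  z ((α i).1, i) - z ((α i).2, i)

/-- The combination `∑_α c_α ∏_i ψ_i^{(d_i)}(z_{p_i}^{(i)} - z_{q_i}^{(i)})`. -/
def pairSum {n k : ℕ} (ψ : Fin k → ℝ → ℝ) (c : (Fin k → Fin n × Fin n) → ℝ) (d : Fin k → ℕ) :
    Pt n k → ℝ := fun z =>
  ∑ α ∈ pairSeqs n k, c α * ∏ i, deriv^[d i] (ψ i) (pairDiff α i z)

/-- The points whose `o`-th layer of coordinates is pairwise distinct. -/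
def distinctAt (n : ℕ) {k : ℕ} (o : Fin k) : Set (Pt n k) :=
  {z | Function.Injective fun i : Fin n => z (i, o)}

/-- The functions `ψ i` are analytic everywhere, except that `ψ o` may be singular at `0`. -/
def AnalyticOff {k : ℕ} (o : Fin k) (ψ : Fin k → ℝ → ℝ) : Prop :=
  ∀ i x, (i = o → x ≠ 0) → AnalyticAt ℝ (ψ i) x

lemma isOpen_distinctAt (n : ℕ) {k : ℕ} (o : Fin k) : IsOpen (distinctAt n o) := by
  have h : distinctAt n o = ⋂ a : Fin n, ⋂ b : Fin n, {z | a ≠ b → z (a, o) ≠ z (b, o)} := by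
    ext z
    simp only [distinctAt, Set.mem_ofPred_eq, Set.mem_iInter]
    exact ⟨fun h a b hab e => hab (h e), fun h a b e => by_contra fun hab => h a b hab e⟩
  rw [h]
  refine isOpen_iInter_of_finite fun a => isOpen_iInter_of_finite fun b => ?_
  by_cases hab : a = b
  · simp [hab]
  · simpa [hab] using isOpen_ne_fun (continuous_apply (a, o)) (continuous_apply (b, o))

lemma pd_congr {n k : ℕ} {U : Set (Pt n k)} (hU : IsOpen U) (v : Fin n × Fin k)
    {f g : Pt n k → ℝ} (h : Set.EqOn f g U) : Set.EqOn (pd v f) (pd v g) U := fun z hz => by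
  unfold pd
  rw [(Filter.eventuallyEq_of_mem (hU.mem_nhds hz) h).fderiv_eq]

lemma foldl_pd_congr {n k : ℕ} {U : Set (Pt n k)} (hU : IsOpen U) (g : Fin k → Fin n)
    (l : List (Fin k)) {f f' : Pt n k → ℝ} (h : Set.EqOn f f' U) :
    Set.EqOn (l.foldl (fun h j => pd (g j, j) h) f) (l.foldl (fun h j => pd (g j, j) h) f') U := by
  induction l generalizing f f' with
  | nil => exact h
  | cons j l ih => exact ih (pd_congr hU _ h)

lemma pdI_congr {n k : ℕ} {U : Set (Pt n k)} (hU : IsOpen U) (I : Finset (Fin n))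
    {f f' : Pt n k → ℝ} (h : Set.EqOn f f' U) : Set.EqOn (pdI I f) (pdI I f') U :=
  fun _ hz => Finset.sum_congr rfl fun g _ => foldl_pd_congr hU g _ h hz

lemma analyticAt_iterate_deriv {f : ℝ → ℝ} {x : ℝ} (h : AnalyticAt ℝ f x) (d : ℕ) :
    AnalyticAt ℝ (deriv^[d] f) x := by
  induction d with
  | zero => exact h
  | succ d ih => rw [Function.iterate_succ_apply']; exact ih.deriv

lemma pairDiff_ne_zero {n k : ℕ} {o : Fin k} {z : Pt n k} (hz : z ∈ distinctAt n o)
    {α : Fin k → Fin n × Fin n} (hα : α ∈ pairSeqs n k) : pairDiff α o z ≠ 0 := by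
  have hlt := ((Finset.mem_filter.mp hα).2.1 o).ne
  exact sub_ne_zero.mpr fun e => hlt (hz e)

lemma hasFDerivAt_pairDiff {n k : ℕ} (α : Fin k → Fin n × Fin n) (i : Fin k) (z : Pt n k) :
    HasFDerivAt (pairDiff α i)
      (ContinuousLinearMap.proj (R := ℝ) (φ := fun _ : Fin n × Fin k => ℝ) ((α i).1, i) -
        ContinuousLinearMap.proj ((α i).2, i)) z :=
  (hasFDerivAt_apply _ z).sub (hasFDerivAt_apply _ z)

lemma pairDiff_single_of_ne {n k : ℕ} (α : Fin k → Fin n × Fin n) {i j : Fin k} (h : i ≠ j)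
    (m : Fin n) : pairDiff α i (Pi.single (m, j) 1) = 0 := by
  simp [pairDiff, h]

lemma pd_pairSum {n k : ℕ} {o : Fin k} {ψ : Fin k → ℝ → ℝ} (hψ : AnalyticOff o ψ)
    (c : (Fin k → Fin n × Fin n) → ℝ) (d : Fin k → ℕ) (m : Fin n) (j : Fin k) :
    Set.EqOn (pd (m, j) (pairSum ψ c d))
      (pairSum ψ (fun α => c α * pairDiff α j (Pi.single (m, j) 1)) (d + Pi.single j 1))
      (distinctAt n o) := by
  intro z hz
  have key : ∀ α ∈ pairSeqs n k, HasFDerivAt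
      (fun z => c α * ∏ i, deriv^[d i] (ψ i) (pairDiff α i z)) _ z := fun α hα =>
    (HasFDerivAt.finsetProd (u := Finset.univ) fun i _ =>
      (analyticAt_iterate_deriv (hψ i (pairDiff α i z) (by
        rintro rfl; exact pairDiff_ne_zero hz hα)) (d i)).differentiableAt.hasDerivAt.comp_hasFDerivAt
          z (hasFDerivAt_pairDiff α i z)).const_mul (c α)
  have hsum := HasFDerivAt.fun_sum key
  unfold pd
  rw [show pairSum ψ c d = fun z => ∑ α ∈ pairSeqs n k,
    c α * ∏ i, deriv^[d i] (ψ i) (pairDiff α i z) from rfl, hsum.fderiv]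
  simp only [pairSum, sum_apply, smul_apply, sub_apply, ContinuousLinearMap.proj_apply, smul_eq_mul]
  refine Finset.sum_congr rfl fun α _ => ?_
  rw [Finset.sum_eq_single j, mul_assoc, ← Finset.mul_prod_erase _ _ (Finset.mem_univ j)]
  · have hne : ∀ i ∈ Finset.univ.erase j,
        deriv^[(d + Pi.single j 1 : Fin k → ℕ) i] (ψ i) (pairDiff α i z) =
          deriv^[d i] (ψ i) (pairDiff α i z) := fun i hi => by
      simp [Finset.ne_of_mem_erase hi]
    rw [Finset.prod_congr rfl hne]
    simp only [Pi.add_apply, Pi.single_eq_same, Function.iterate_succ_apply']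
    simp only [pairDiff, Function.comp_apply]
    ring
  · intro i _ hij
    have := pairDiff_single_of_ne α hij m
    unfold pairDiff at this
    rw [this]
    ring
  · simp

lemma foldl_pd_pairSum {n k : ℕ} {o : Fin k} {ψ : Fin k → ℝ → ℝ} (hψ : AnalyticOff o ψ)
    (g : Fin k → Fin n) (l : List (Fin k)) (c : (Fin k → Fin n × Fin n) → ℝ) (d : Fin k → ℕ) :
    Set.EqOn (l.foldl (fun h j => pd (g j, j) h) (pairSum ψ c d))
      (pairSum ψ (fun α => c α * (l.map fun j => pairDiff α j (Pi.single (g j, j) 1)).prod)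
        (d + fun i => l.count i)) (distinctAt n o) := by
  induction l generalizing c d with
  | nil =>
    intro z _
    simp [pairSum]
  | cons j l ih =>
    refine ((foldl_pd_congr (isOpen_distinctAt n o) g l (pd_pairSum hψ c d (g j) j)).trans
      (ih _ _)).trans fun z _ => ?_
    have hd : d + Pi.single j 1 + (fun i => l.count i) = d + fun i => (j :: l).count i := by
      funext i
      by_cases h : i = j
      · subst h; simp; ring
      · simp [h, List.count_cons, Ne.symm h]
    rw [hd]
    simp [pairSum, mul_assoc]

/-- The coefficient by which `∂_I` acts on the summand indexed by `α`. -/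
def pairCoeff {n k : ℕ} (I : Finset (Fin n)) (α : Fin k → Fin n × Fin n) : ℝ :=
  ∑ g ∈ Finset.univ.filter (fun g : Fin k → Fin n => Function.Injective g ∧ ∀ j, g j ∈ I),
    ((List.finRange k).map fun j => pairDiff α j (Pi.single (g j, j) 1)).prod

lemma pdI_pairSum {n k : ℕ} {o : Fin k} {ψ : Fin k → ℝ → ℝ} (hψ : AnalyticOff o ψ)
    (I : Finset (Fin n)) (c : (Fin k → Fin n × Fin n) → ℝ) (d : Fin k → ℕ) :
    Set.EqOn (pdI I (pairSum ψ c d)) (pairSum ψ (fun α => c α * pairCoeff I α) (d + 1))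
      (distinctAt n o) := by
  intro z hz
  have hd : (d + fun i => (List.finRange k).count i) = d + 1 := by
    funext i
    simp
  have h : ∀ g, pdSeq g (pairSum ψ c d) z = _ := fun g =>
    foldl_pd_pairSum hψ g (List.finRange k) c d hz
  simp only [pdI, h, hd, pairSum, pairCoeff, Finset.mul_sum, Finset.sum_mul]
  rw [Finset.sum_comm]

lemma pdI_pdI_pairSum {n k : ℕ} {o : Fin k} {ψ : Fin k → ℝ → ℝ} (hψ : AnalyticOff o ψ)
    (I J : Finset (Fin n)) (c : (Fin k → Fin n × Fin n) → ℝ) :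
    Set.EqOn (pdI I (pdI J (pairSum ψ c 0)))
      (pairSum ψ (fun α => c α * pairCoeff J α * pairCoeff I α) 2) (distinctAt n o) := by
  have h := (pdI_congr (isOpen_distinctAt n o) I (pdI_pairSum hψ J c 0)).trans
    (pdI_pairSum hψ I _ _)
  rwa [show (0 + 1 + 1 : Fin k → ℕ) = 2 by norm_num] at h

lemma sum_mul_pairDiff_single {n k : ℕ} (α : Fin k → Fin n × Fin n) (j : Fin k) (z : Pt n k) :
    ∑ m, z (m, j) * pairDiff α j (Pi.single (m, j) 1) = pairDiff α j z := by
  simp [pairDiff, Pi.single_apply, mul_sub, Finset.sum_sub_distrib]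

lemma iterate_two_deriv_sq (x : ℝ) : deriv^[2] (fun x : ℝ => x ^ 2) x = 2 := by
  have h : deriv (fun x : ℝ => x ^ 2) = fun x => 2 * x := by
    funext y
    simp
  simp only [Function.iterate_succ_apply', Function.iterate_zero, id_eq, h]
  simp

lemma deriv_log_mul_sq {x : ℝ} (hx : x ≠ 0) :
    deriv (fun x => Real.log x * x ^ 2) x = 2 * x * Real.log x + x := by
  have h := (Real.hasDerivAt_log hx).mul (hasDerivAt_pow 2 x)
  refine h.deriv.trans ?_
  field_simp
  ring

lemma iterate_two_deriv_log_mul_sq {x : ℝ} (hx : x ≠ 0) :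
    deriv^[2] (fun x => Real.log x * x ^ 2) x = 2 * Real.log x + 3 := by
  have he : deriv (fun x => Real.log x * x ^ 2) =ᶠ[nhds x] fun x => 2 * x * Real.log x + x :=
    Filter.eventuallyEq_of_mem (isOpen_ne.mem_nhds hx) fun y hy => deriv_log_mul_sq hy
  have h := (((hasDerivAt_id x).const_mul 2).mul (Real.hasDerivAt_log hx)).add (hasDerivAt_id x)
  simp only [Function.iterate_succ_apply', Function.iterate_zero, id_eq]
  refine he.deriv_eq.trans (h.deriv.trans ?_)
  simp only [id]
  field_simp
  ring

lemma iterate_three_deriv_log_mul_sq {x : ℝ} (hx : x ≠ 0) :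
    deriv^[3] (fun x => Real.log x * x ^ 2) x = 2 / x := by
  have he : deriv^[2] (fun x => Real.log x * x ^ 2) =ᶠ[nhds x] fun x => 2 * Real.log x + 3 :=
    Filter.eventuallyEq_of_mem (isOpen_ne.mem_nhds hx) fun y hy => iterate_two_deriv_log_mul_sq hy
  have h := ((Real.hasDerivAt_log hx).const_mul 2).add_const 3
  rw [Function.iterate_succ_apply']
  exact he.deriv_eq.trans h.deriv

/-- The one-variable factors of the potential of the second kind. -/
def logFactor {k : ℕ} (o i : Fin k) : ℝ → ℝ :=
  if i = o then fun x => Real.log x * x ^ 2 else fun x => x ^ 2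

lemma analyticOff_sq {k : ℕ} (o : Fin k) : AnalyticOff o fun _ x => x ^ 2 :=
  fun _ _ _ => analyticAt_id.pow 2

lemma analyticOff_logFactor {k : ℕ} (o : Fin k) : AnalyticOff o (logFactor o) := by
  intro i x hx
  unfold logFactor
  split_ifs with h
  · exact (Real.contDiffAt_log.mpr (hx h)).analyticAt.mul (analyticAt_id.pow 2)
  · exact analyticAt_id.pow 2

lemma Pfun_eq_pairSum (n k : ℕ) :
    Pfun n k = pairSum (fun _ x => x ^ 2) (fun _ => c1 n k) 0 := by
  funext z
  simp [Pfun, pairSum, pairDiff, Finset.mul_sum]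

lemma Qfun_eq_pairSum (n k : ℕ) (hk : 0 < k) :
    Qfun n k hk = pairSum (logFactor ⟨0, hk⟩) (fun _ => c2 n k) 0 := by
  funext z
  simp only [Qfun, pairSum, Finset.mul_sum]
  refine Finset.sum_congr rfl fun α _ => ?_
  rw [← Finset.mul_prod_erase _ _ (Finset.mem_univ (⟨0, hk⟩ : Fin k)),
    ← Finset.mul_prod_erase (a := (⟨0, hk⟩ : Fin k)) _ _ (Finset.mem_univ _)]
  have hne : ∀ i ∈ Finset.univ.erase (⟨0, hk⟩ : Fin k),
      deriv^[(0 : Fin k → ℕ) i] (logFactor ⟨0, hk⟩ i) (pairDiff α i z) =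
        (z ((α i).1, i) - z ((α i).2, i)) ^ 2 := fun i hi => by
    simp [logFactor, Finset.ne_of_mem_erase hi, pairDiff]
  rw [Finset.prod_congr rfl hne]
  simp [logFactor, pairDiff, Real.log_abs, mul_assoc]

lemma c1_ne_zero (n k : ℕ) : c1 n k ≠ 0 := by
  unfold c1
  positivity

lemma c2_ne_zero (n k : ℕ) : c2 n k ≠ 0 := by
  unfold c2
  rw [neg_div, neg_ne_zero]
  positivity

/-- Multiplied by the difference in layer `o`, the third derivative in that layer of the
logarithmic factors agrees with the second derivatives of the squares. -/
lemma pairDiff_mul_prod_logFactor {n k : ℕ} {o : Fin k} {z : Pt n k} (hz : z ∈ distinctAt n o)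
    {α : Fin k → Fin n × Fin n} (hα : α ∈ pairSeqs n k) :
    pairDiff α o z *
        ∏ i, deriv^[(2 + Pi.single o 1 : Fin k → ℕ) i] (logFactor o i) (pairDiff α i z) =
      ∏ i, deriv^[(2 : Fin k → ℕ) i] (fun x => x ^ 2) (pairDiff α i z) := by
  have h0 := pairDiff_ne_zero hz hα
  rw [← Finset.mul_prod_erase _ _ (Finset.mem_univ o),
    ← Finset.mul_prod_erase (a := o) (Finset.univ)
      (fun i => deriv^[(2 : Fin k → ℕ) i] (fun x => x ^ 2) (pairDiff α i z)) (Finset.mem_univ _),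
    ← mul_assoc]
  congr 1
  · have : (2 + Pi.single o 1 : Fin k → ℕ) o = 3 := by simp
    rw [this, show logFactor o o = fun x => Real.log x * x ^ 2 by simp [logFactor],
      iterate_three_deriv_log_mul_sq h0]
    exact (mul_div_cancel₀ _ h0).trans (iterate_two_deriv_sq _).symm
  · refine Finset.prod_congr rfl fun i hi => ?_
    simp [logFactor, Finset.ne_of_mem_erase hi]

/-- for real `z = (z_i^{(j)})` with `z_1^{(1)},…,z_n^{(1)}` pairwise
distinct and `k`-element subsets `I, J`,
`(1/c₁) ∂_I ∂_J P (z) = (1/c₂) ∑_m z_m^{(1)} ∂/∂z_m^{(1)} ∂_I ∂_J Q (z)`. -/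
theorem stmt15 (n k : ℕ) (hk : 1 ≤ k) (hn : 2 * k ≤ n)
    (z : Pt n k) (hz : Function.Injective fun i : Fin n => z (i, ⟨0, hk⟩))
    (I J : Finset (Fin n)) (hI : I.card = k) (hJ : J.card = k) :
    (1 / c1 n k) * pdI I (pdI J (Pfun n k)) z =
      (1 / c2 n k) *
        ∑ m : Fin n,
          z (m, ⟨0, hk⟩) * pd (m, ⟨0, hk⟩) (pdI I (pdI J (Qfun n k hk))) z := by
  have hz' : z ∈ distinctAt n (⟨0, hk⟩ : Fin k) := hz
  have hP := pdI_pdI_pairSum (analyticOff_sq _) I J (fun _ => c1 n k) hz'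
  have hQ := fun m => ((pd_congr (isOpen_distinctAt n _) (m, ⟨0, hk⟩)
    (pdI_pdI_pairSum (analyticOff_logFactor _) I J (fun _ => c2 n k))).trans
      (pd_pairSum (analyticOff_logFactor _) _ _ _ _)) hz'
  rw [Qfun_eq_pairSum]
  simp only [hQ]
  rw [Pfun_eq_pairSum, hP]
  simp only [pairSum, Finset.mul_sum]
  rw [Finset.sum_comm]
  refine Finset.sum_congr rfl fun α hα => ?_
  rw [← pairDiff_mul_prod_logFactor hz' hα, ← sum_mul_pairDiff_single, Finset.sum_mul,
    Finset.mul_sum, Finset.mul_sum]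
  refine Finset.sum_congr rfl fun m _ => ?_
  have h1 := c1_ne_zero n k
  have h2 := c2_ne_zero n k
  field_simp
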